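/- Let n ≥ 1, let θ = (θ_{jk}) be a real antisymmetric n×n matrix, and set λ^{jk} = exp(2πiθ_{jk}) (so λ^{kj} = (λ^{jk})^{−1} and λ^{jj} = 1). Let M be a unital *-algebra over ℂ containing elements Γ¹, …, Γⁿ satisfying, for all j, k: Γ^j Γ^k + λ^{kj} Γ^k Γ^j = 0; (Γ^j)* (Γ^k)* + λ^{kj} (Γ^k)* (Γ^j)* = 0; and Γ^j (Γ^k)* + λ^{jk} (Γ^k)* Γ^j = δ^{jk}·1. Then the element γ := Π_{j=1}^{n} ((Γ^j)* Γ^j − Γ^j (Γ^j)*) (product taken in the order j = 1, …, n) satisfies: γ* = γ, γ² = 1, and γ Γ^j + Γ^j γ = 0 and γ (Γ^j)* + (Γ^j)* γ = 0 for every j. -/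

import Mathlib

section ListProd

variable {ι M : Type*}

/-- A product of pairwise commuting self-adjoint elements is self-adjoint. -/
theorem List.isSelfAdjoint_prod_map [Monoid M] [StarMul M] (f : ι → M)
    (hs : ∀ i, IsSelfAdjoint (f i)) (hc : ∀ i j, Commute (f i) (f j)) (l : List ι) :
    IsSelfAdjoint (l.map f).prod := by
  induction l with
  | nil => simp
  | cons a l ih =>
    rw [List.map_cons, List.prod_cons]
    refine ((hs a).commute_iff ih).1 (Commute.list_prod_right _ _ ?_)
    simpa using fun b _ => hc a b

/-- A product of pairwise commuting involutions is an involution. -/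
theorem List.prod_map_mul_self_eq_one [Monoid M] (f : ι → M)
    (hf : ∀ i, f i * f i = 1) (hc : ∀ i j, Commute (f i) (f j)) (l : List ι) :
    (l.map f).prod * (l.map f).prod = 1 := by
  induction l with
  | nil => simp
  | cons a l ih =>
    have h : Commute (f a) (l.map f).prod :=
      Commute.list_prod_right _ _ (by simpa using fun b _ => hc a b)
    rw [List.map_cons, List.prod_cons, h.symm.mul_mul_mul_comm, hf, ih, mul_one]

/-- If `x` anticommutes with exactly one factor of a product and commutes with the others,
then it anticommutes with the product. -/
theorem List.prod_map_mul_add_mul_prod_map_eq_zero [Ring M] (f : ι → M) (x : M) (j : ι)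
    (hj : f j * x + x * f j = 0) (hne : ∀ i, i ≠ j → Commute (f i) x)
    (l : List ι) (hl : l.Nodup) (hjl : j ∈ l) :
    (l.map f).prod * x + x * (l.map f).prod = 0 := by
  induction l with
  | nil => simp at hjl
  | cons a l ih =>
    rw [List.nodup_cons] at hl
    rw [List.map_cons, List.prod_cons]
    by_cases haj : a = j
    · subst haj
      have h : Commute (l.map f).prod x := by
        refine Commute.list_prod_left _ _ ?_
        simpa using fun b hb => hne b fun hba => hl.1 (hba ▸ hb)
      rw [mul_assoc, h.eq, ← mul_assoc, ← mul_assoc, ← add_mul, hj, zero_mul]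
    · have hjl' : j ∈ l := by simpa [Ne.symm haj] using hjl
      rw [← mul_assoc x, ← (hne a haj).eq, mul_assoc, mul_assoc, ← mul_add, ih hl.2 hjl',
        mul_zero]

end ListProd

section Fermion

variable {M : Type*} [Ring M]

/-- For a fermionic pair `a`, `b`, the element `b * a - a * b` is an involution. -/
theorem fermion_commutator_mul_self {a b : M} (ha : a * a = 0) (hb : b * b = 0)
    (hab : a * b + b * a = 1) : (b * a - a * b) * (b * a - a * b) = 1 := by
  have h : (b * a - a * b) * (b * a - a * b) = (a * b + b * a) * (a * b + b * a)
      - 2 • (b * (a * a) * b) - 2 • (a * (b * b) * a) := by noncomm_ring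
  simp [h, ha, hb, hab]

/-- For a fermionic pair `a`, `b`, the element `b * a - a * b` anticommutes with `a`. -/
theorem fermion_commutator_anticommute {a : M} (b : M) (ha : a * a = 0) :
    (b * a - a * b) * a + a * (b * a - a * b) = 0 := by
  have h : (b * a - a * b) * a + a * (b * a - a * b) = b * (a * a) - a * a * b := by
    noncomm_ring
  simp [h, ha]

/-- If `x` skew-commutes with `a` and `b` with mutually inverse factors, then it commutes
with `b * a - a * b`. -/
theorem commute_commutator_of_skew_commute {R : Type*} [CommRing R] [Algebra R M]
    {a b x : M} {p q : R} (hpq : p * q = 1) (ha : x * a + p • (a * x) = 0)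
    (hb : x * b + q • (b * x) = 0) : Commute (b * a - a * b) x := by
  have ha' : x * a = -(p • (a * x)) := eq_neg_of_add_eq_zero_left ha
  have hb' : x * b = -(q • (b * x)) := eq_neg_of_add_eq_zero_left hb
  have hba : x * (b * a) = b * a * x := by
    rw [← mul_assoc, hb', neg_mul, smul_mul_assoc, mul_assoc, ha', mul_neg, mul_smul_comm,
      smul_neg, neg_neg, smul_smul, mul_comm q, hpq, one_smul, mul_assoc]
  have hab : x * (a * b) = a * b * x := by
    rw [← mul_assoc, ha', neg_mul, smul_mul_assoc, mul_assoc, hb', mul_neg, mul_smul_comm,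
      smul_neg, neg_neg, smul_smul, hpq, one_smul, mul_assoc]
  rw [commute_iff_eq, sub_mul, mul_sub, hba, hab]

end Fermion


/-- In the θ-deformed Clifford algebra `Cliff(ℝ_θ^{2n})`, the grading element
`γ = [Γ^{1*}, Γ¹] ⋯ [Γ^{n*}, Γⁿ]` is self-adjoint, squares to `1`, and
anticommutes with every generator `Γ^j` and `(Γ^j)*`. -/
theorem theta_clifford_grading_element
    (n : ℕ) (hn : 1 ≤ n) (θ : Fin n → Fin n → ℝ) (hθ : ∀ j k, θ j k = -θ k j)
    (M : Type*) [Ring M] [Algebra ℂ M] [StarRing M] [StarModule ℂ M]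
    (lam : Fin n → Fin n → ℂ)
    (hlam : ∀ j k, lam j k = Complex.exp (2 * Real.pi * Complex.I * (θ j k : ℂ)))
    (Γ : Fin n → M)
    (h1 : ∀ j k, Γ j * Γ k + lam k j • (Γ k * Γ j) = 0)
    (h2 : ∀ j k, star (Γ j) * star (Γ k) + lam k j • (star (Γ k) * star (Γ j)) = 0)
    (h3 : ∀ j k, Γ j * star (Γ k) + lam j k • (star (Γ k) * Γ j)
      = if j = k then 1 else 0) :
    let γ : M := ((List.finRange n).map fun j => star (Γ j) * Γ j - Γ j * star (Γ j)).prod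
    star γ = γ ∧ γ * γ = 1 ∧
      (∀ j, γ * Γ j + Γ j * γ = 0) ∧
      (∀ j, γ * star (Γ j) + star (Γ j) * γ = 0) := by
  intro γ
  set c : Fin n → M := fun j => star (Γ j) * Γ j - Γ j * star (Γ j) with hc
  have hlam_diag : ∀ j, lam j j = 1 := fun j => by
    have : θ j j = 0 := by linarith [hθ j j]
    simp [hlam, this]
  have hlam_inv : ∀ j k, lam j k * lam k j = 1 := fun j k => by
    rw [hlam, hlam, ← Complex.exp_add, hθ j k]
    simp
  have hsq : ∀ j, Γ j * Γ j = 0 := fun j => by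
    have h := h1 j j
    rw [hlam_diag, one_smul, ← two_smul ℂ] at h
    exact (smul_eq_zero_iff_right two_ne_zero).1 h
  have hsq_star : ∀ j, star (Γ j) * star (Γ j) = 0 := fun j => by
    rw [← star_mul, hsq, star_zero]
  have hcar : ∀ j, Γ j * star (Γ j) + star (Γ j) * Γ j = 1 := fun j => by
    simpa [hlam_diag] using h3 j j
  have hself : ∀ j, IsSelfAdjoint (c j) := fun j => by
    simp [IsSelfAdjoint, hc]
  have hcomm : ∀ k j, k ≠ j → Commute (c k) (Γ j) := fun k j hkj =>
    commute_commutator_of_skew_commute (hlam_inv k j) (h1 j k)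
      (by simpa [hkj.symm] using h3 j k)
  have hcomm_star : ∀ k j, k ≠ j → Commute (c k) (star (Γ j)) := fun k j hkj => by
    simpa only [(hself k).star_eq] using (hcomm k j hkj).star_star
  have hpair : ∀ k j, Commute (c k) (c j) := fun k j => by
    obtain rfl | hkj := eq_or_ne k j
    · exact Commute.refl _
    · have h := hcomm k j hkj
      have h' := hcomm_star k j hkj
      exact (h'.mul_right h).sub_right (h.mul_right h')
  have hanti : ∀ j, γ * Γ j + Γ j * γ = 0 := fun j =>
    List.prod_map_mul_add_mul_prod_map_eq_zero c (Γ j) j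
      (fermion_commutator_anticommute _ (hsq j)) (fun k => hcomm k j) _
      (List.nodup_finRange n) (List.mem_finRange j)
  have hγ : star γ = γ := List.isSelfAdjoint_prod_map c hself hpair _
  refine ⟨hγ, List.prod_map_mul_self_eq_one c
    (fun j => fermion_commutator_mul_self (hsq j) (hsq_star j) (hcar j)) hpair _, hanti,
    fun j => ?_⟩
  have h := congrArg star (hanti j)
  rwa [star_add, star_mul, star_mul, hγ, star_zero, add_comm] at h
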